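/- Let X be a Poisson random variable with mean m > 0. Then E|X − m|^3 = m·(1 − 2·F(m)) + 2·((m − ⌊m⌋)^2 + 2·⌊m⌋ + 1)·e^{-m}·m^{⌊m⌋+1}/⌊m⌋!, where F(m) = P(X ≤ m) and ⌊·⌋ denotes the floor function. -/

import Mathlib

/-- The Poisson probability mass at `j` for a Poisson distribution with mean `m`:
`P(X = j) = e^{-m} m^j / j!`. -/
noncomputable def poissonWeight (m : ℝ) (j : ℕ) : ℝ :=
  Real.exp (-m) * m ^ j / (Nat.factorial j : ℝ)

/-- `poissonCDF m b = P(X ≤ b)`, the cumulative distribution function of a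
Poisson random variable `X` with mean `m`. -/
noncomputable def poissonCDF (m b : ℝ) : ℝ :=
  ∑' j : ℕ, if (j : ℝ) ≤ b then poissonWeight m j else 0

open Finset Filter Topology

theorem hasSum_poissonWeight (m : ℝ) : HasSum (poissonWeight m) 1 := by
  have h := (NormedSpace.expSeries_div_hasSum_exp m).mul_left (Real.exp (-m))
  rw [← Real.exp_eq_exp_ℝ, ← Real.exp_add, neg_add_cancel, Real.exp_zero] at h
  simp only [← mul_div_assoc] at h
  exact h

theorem poissonWeight_nonneg {m : ℝ} (hm : 0 ≤ m) (j : ℕ) : 0 ≤ poissonWeight m j := by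
  unfold poissonWeight
  positivity

theorem succ_mul_poissonWeight_succ (m : ℝ) (j : ℕ) :
    ((j : ℝ) + 1) * poissonWeight m (j + 1) = m * poissonWeight m j := by
  have h : ((j : ℝ) + 1) ≠ 0 := by positivity
  have h' : (j.factorial : ℝ) ≠ 0 := by positivity
  simp only [poissonWeight, Nat.factorial_succ]
  push_cast
  field_simp
  ring

theorem sum_range_sub_pow_three_mul_poissonWeight (m : ℝ) (n : ℕ) :
    ∑ j ∈ range (n + 1), ((j : ℝ) - m) ^ 3 * poissonWeight m j =
      m * ∑ j ∈ range (n + 1), poissonWeight m j -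
        m * (((n : ℝ) - m) ^ 2 + 2 * n + 1) * poissonWeight m n := by
  induction n with
  | zero =>
    simp only [zero_add, sum_range_one]
    push_cast
    ring
  | succ n ih =>
    rw [sum_range_succ, ih, sum_range_succ _ (n + 1)]
    push_cast
    linear_combination (((n : ℝ) - m) ^ 2 + 2 * n + 1) * succ_mul_poissonWeight_succ m n

theorem tendsto_quadratic_mul_poissonWeight {m : ℝ} (hm : 0 ≤ m) :
    Tendsto (fun n : ℕ ↦ (((n : ℝ) - m) ^ 2 + 2 * n + 1) * poissonWeight m n) atTop (𝓝 0) := by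
  have hlim := (FloorSemiring.tendsto_pow_div_factorial_atTop (4 * m)).const_mul
    (((1 + m) ^ 2 + 2) * Real.exp (-m))
  rw [mul_zero] at hlim
  refine squeeze_zero (fun n ↦ mul_nonneg (by positivity) (poissonWeight_nonneg hm n))
    (fun n ↦ ?_) hlim
  have hn : (0 : ℝ) ≤ n := n.cast_nonneg
  have hpow : ((n : ℝ) + 1) ^ 2 ≤ 4 ^ n := by
    have h : (n : ℝ) + 1 ≤ 2 ^ n := by exact_mod_cast Nat.lt_two_pow_self (n := n)
    calc ((n : ℝ) + 1) ^ 2 ≤ (2 ^ n) ^ 2 := by gcongr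
      _ = 4 ^ n := by rw [pow_right_comm]; norm_num
  have hquad : ((n : ℝ) - m) ^ 2 + 2 * n + 1 ≤ ((1 + m) ^ 2 + 2) * ((n : ℝ) + 1) ^ 2 := by
    have h : ((n : ℝ) - m) ^ 2 ≤ ((1 + m) * ((n : ℝ) + 1)) ^ 2 := by
      apply sq_le_sq'
      · nlinarith [mul_nonneg hm hn]
      · nlinarith [mul_nonneg hm hn]
    nlinarith
  calc _ ≤ (((1 + m) ^ 2 + 2) * 4 ^ n) * poissonWeight m n :=
        mul_le_mul_of_nonneg_right (hquad.trans (by gcongr)) (poissonWeight_nonneg hm n)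
    _ = _ := by
        rw [poissonWeight, mul_pow]
        ring

theorem tendsto_sum_range_sub_pow_three_mul_poissonWeight {m : ℝ} (hm : 0 ≤ m) :
    Tendsto (fun n : ℕ ↦ ∑ j ∈ range n, ((j : ℝ) - m) ^ 3 * poissonWeight m j)
      atTop (𝓝 m) := by
  rw [← tendsto_add_atTop_iff_nat 1]
  have h := (((tendsto_add_atTop_iff_nat 1).2
    (hasSum_poissonWeight m).tendsto_sum_nat).const_mul m).sub
    ((tendsto_quadratic_mul_poissonWeight hm).const_mul m)
  rw [mul_one, mul_zero, sub_zero] at h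
  refine h.congr fun n ↦ ?_
  rw [sum_range_sub_pow_three_mul_poissonWeight]
  ring

theorem poissonCDF_eq_sum_range {m b : ℝ} (hb : 0 ≤ b) :
    poissonCDF m b = ∑ j ∈ range (⌊b⌋₊ + 1), poissonWeight m j := by
  have h (j : ℕ) : (j : ℝ) ≤ b ↔ j ∈ range (⌊b⌋₊ + 1) := by
    rw [mem_range, Nat.lt_succ_iff, Nat.le_floor_iff hb]
  rw [poissonCDF, tsum_eq_sum fun j hj ↦ if_neg (mt (h j).1 hj)]
  exact sum_congr rfl fun j hj ↦ if_pos ((h j).2 hj)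

theorem sum_range_abs_sub_pow_three_mul {m : ℝ} (hm : 0 ≤ m) (w : ℕ → ℝ) {n : ℕ}
    (hn : ⌊m⌋₊ + 1 ≤ n) :
    ∑ j ∈ range n, |(j : ℝ) - m| ^ 3 * w j =
      ∑ j ∈ range n, ((j : ℝ) - m) ^ 3 * w j -
        2 * ∑ j ∈ range (⌊m⌋₊ + 1), ((j : ℝ) - m) ^ 3 * w j := by
  induction n, hn using Nat.le_induction with
  | base =>
    rw [two_mul, sub_add_cancel_left, ← sum_neg_distrib]
    refine sum_congr rfl fun j hj ↦ ?_
    have hj' : (j : ℝ) ≤ m := (Nat.le_floor_iff hm).1 (Nat.lt_succ_iff.1 (mem_range.1 hj))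
    rw [abs_of_nonpos (sub_nonpos.2 hj')]
    ring
  | succ n hn ih =>
    have hn' : m ≤ n := (Nat.lt_of_floor_lt hn).le
    rw [sum_range_succ, ih, sum_range_succ _ n, abs_of_nonneg (sub_nonneg.2 hn')]
    ring

/-- For a Poisson random variable `X` with mean `m > 0`:
`E|X−m|^3 = m·(1 − 2·F(m)) + 2·((m − ⌊m⌋)^2 + 2·⌊m⌋ + 1)·e^{-m}·m^{⌊m⌋+1}/⌊m⌋!`. -/
theorem poisson_third_absolute_central_moment
    (m : ℝ) (hm : 0 < m) :
    (∑' j : ℕ, |(j : ℝ) - m| ^ 3 * poissonWeight m j) =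
      m * (1 - 2 * poissonCDF m m) +
      2 * ((m - (⌊m⌋₊ : ℝ)) ^ 2 + 2 * (⌊m⌋₊ : ℝ) + 1) * Real.exp (-m) *
        m ^ (⌊m⌋₊ + 1) / (Nat.factorial ⌊m⌋₊ : ℝ) := by
  have hlim := (tendsto_sum_range_sub_pow_three_mul_poissonWeight hm.le).sub_const
    (2 * ∑ j ∈ range (⌊m⌋₊ + 1), ((j : ℝ) - m) ^ 3 * poissonWeight m j)
  have hsum : HasSum (fun j : ℕ ↦ |(j : ℝ) - m| ^ 3 * poissonWeight m j)
      (m - 2 * ∑ j ∈ range (⌊m⌋₊ + 1), ((j : ℝ) - m) ^ 3 * poissonWeight m j) := by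
    refine (hasSum_iff_tendsto_nat_of_nonneg
      (fun j ↦ mul_nonneg (by positivity) (poissonWeight_nonneg hm.le j)) _).2
      (hlim.congr' ?_)
    filter_upwards [eventually_ge_atTop (⌊m⌋₊ + 1)] with n hn
    rw [sum_range_abs_sub_pow_three_mul hm.le _ hn]
  rw [hsum.tsum_eq, sum_range_sub_pow_three_mul_poissonWeight, poissonCDF_eq_sum_range hm.le,
    poissonWeight.eq_def m ⌊m⌋₊]
  ring
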